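/- arXiv:2001.04004 — 8 statements merged into one kernel-verified Lean document; each statement's English description precedes it below -/
import Mathlib

section
/- For every i with 0 ≤ i ≤ a2, the representation M(r_i) has exactly a1·a2 + 1 subrepresentations. -/
inductive V (a1 a2 : ℕ) : Type where
  | r : Fin (a2 + 1) → V a1 a2
  | s : Fin (a1 - 1) → V a1 a2
  | t : Fin (a1 - 1) → V a1 a2

def Arrow (a1 a2 : ℕ) : V a1 a2 → V a1 a2 → Prop
  | .r i, .r j => ((i : ℕ) + 1 = (j : ℕ)) ∨ ((i : ℕ) = a2 ∧ (j : ℕ) = 0)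
  | .s i, .s j => (i : ℕ) + 1 = (j : ℕ)
  | .s i, .r j => (i : ℕ) = a1 - 2 ∧ (j : ℕ) = a2
  | .r i, .t j => (i : ℕ) = 0 ∧ (j : ℕ) = 0
  | .t i, .t j => (i : ℕ) + 1 = (j : ℕ)
  | _, _ => False

structure Repn (k : Type) [Field k] (a1 a2 : ℕ) : Type 1 where
  carrier : V a1 a2 → Type
  [acg : ∀ x, AddCommGroup (carrier x)]
  [mod : ∀ x, Module k (carrier x)]
  fd : ∀ x, FiniteDimensional k (carrier x)
  map : ∀ (x y : V a1 a2), Arrow a1 a2 x y → (carrier x →ₗ[k] carrier y)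

attribute [instance] Repn.acg Repn.mod

def HomSpace {k : Type} [Field k] {a1 a2 : ℕ} (ρ σ : Repn k a1 a2) :
    Submodule k (∀ x : V a1 a2, ρ.carrier x →ₗ[k] σ.carrier x) where
  carrier := {f | ∀ (x y : V a1 a2) (h : Arrow a1 a2 x y),
      (σ.map x y h).comp (f x) = (f y).comp (ρ.map x y h)}
  add_mem' := by
    intro f g hf hg
    intro x y h
    simp only [Pi.add_apply, LinearMap.comp_add, LinearMap.add_comp]
    rw [hf x y h, hg x y h]
  zero_mem' := by
    intro x y h
    simp
  smul_mem' := by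
    intro c f hf
    intro x y h
    simp only [Pi.smul_apply, LinearMap.comp_smul, LinearMap.smul_comp]
    rw [hf x y h]

def IsSubrep {k : Type} [Field k] {a1 a2 : ℕ} (ρ : Repn k a1 a2)
    (N : ∀ x, Submodule k (ρ.carrier x)) : Prop :=
  ∀ (x y : V a1 a2) (h : Arrow a1 a2 x y), ∀ v ∈ N x, ρ.map x y h v ∈ N y

open Classical in
noncomputable def sp (k : Type) [Field k] {a1 a2 : ℕ} (S : Set (V a1 a2)) (x : V a1 a2) :
    Submodule k k :=
  if x ∈ S then ⊤ else ⊥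

open Classical in
noncomputable def thinMap (k : Type) [Field k] {a1 a2 : ℕ} (S T : Set (V a1 a2))
    (x y : V a1 a2) : (sp k S x) →ₗ[k] (sp k T y) where
  toFun v := if h : y ∈ T then ⟨(v : k), by simp [sp, h]⟩ else 0
  map_add' u v := by
    by_cases h : y ∈ T
    · simp only [dif_pos h]
      exact Subtype.ext (by simp)
    · simp [dif_neg h]
  map_smul' c v := by
    by_cases h : y ∈ T
    · simp only [dif_pos h]
      exact Subtype.ext (by simp)
    · simp [dif_neg h]

noncomputable def thinRep (k : Type) [Field k] {a1 a2 : ℕ} (S : Set (V a1 a2)) :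
    Repn k a1 a2 where
  carrier x := ↥(sp k S x)
  acg := fun _ => inferInstance
  mod := fun _ => inferInstance
  fd := fun _ => inferInstance
  map x y _ := thinMap k S S x y

def suppR (a1 a2 : ℕ) (i : ℕ) : Set (V a1 a2) :=
  {x | match x with
      | .r j => (j : ℕ) ≠ i
      | .s _ => i ≠ a2
      | .t _ => i ≠ 0}

def suppS (a1 a2 : ℕ) (i : ℕ) : Set (V a1 a2) :=
  {x | match x with
      | .r j => (j : ℕ) < a2
      | .s _ => False
      | .t j => (j : ℕ) + 1 < i}

def suppT (a1 a2 : ℕ) (i : ℕ) : Set (V a1 a2) :=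
  {x | match x with
      | .r j => 1 ≤ (j : ℕ)
      | .s j => i ≤ (j : ℕ)
      | .t _ => False}

noncomputable def Mr (k : Type) [Field k] (a1 a2 : ℕ) (i : ℕ) : Repn k a1 a2 :=
  thinRep k (suppR a1 a2 i)

noncomputable def Ms (k : Type) [Field k] (a1 a2 : ℕ) (i : ℕ) : Repn k a1 a2 :=
  thinRep k (suppS a1 a2 i)

noncomputable def Mt (k : Type) [Field k] (a1 a2 : ℕ) (i : ℕ) : Repn k a1 a2 :=
  thinRep k (suppT a1 a2 i)

noncomputable def Mv (k : Type) [Field k] (a1 a2 : ℕ) : V a1 a2 → Repn k a1 a2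
  | .r j => Mr k a1 a2 (j : ℕ)
  | .s j => Ms k a1 a2 ((j : ℕ) + 1)
  | .t j => Mt k a1 a2 ((j : ℕ) + 1)

open Classical in
theorem cardThin (k : Type) [Field k] {a1 a2 : ℕ} (S : Set (V a1 a2)) :
    Nat.card {N : ∀ x : V a1 a2, Submodule k ((thinRep k S).carrier x) //
        IsSubrep (thinRep k S) N} =
    Nat.card {T : Set (V a1 a2) // T ⊆ S ∧
        ∀ x y, Arrow a1 a2 x y → x ∈ T → y ∈ S → y ∈ T} := by
  have key : ∀ (x : V a1 a2) (N : Submodule k (sp k S x)) (v : sp k S x), v ∈ N → v ≠ 0 →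
      ∀ w : sp k S x, w ∈ N := by
    intro x N v hv hv0 w
    have h0 : (v : k) ≠ 0 := fun h => hv0 (Subtype.ext h)
    have : w = ((w : k) / (v : k)) • v := by
      apply Subtype.ext
      simp [div_mul_cancel₀ _ h0]
    rw [this]
    exact N.smul_mem _ hv
  have supp : ∀ (x : V a1 a2) (v : sp k S x), v ≠ 0 → x ∈ S := by
    intro x v hv
    by_contra hx
    apply hv
    apply Subtype.ext
    have hsp : sp k S x = ⊥ := if_neg hx
    exact (Submodule.mem_bot k).1 (hsp.le v.2)
  have nz : ∀ x ∈ S, ∃ v : sp k S x, v ≠ 0 := by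
    intro x hx
    refine ⟨⟨1, by simp [sp, hx]⟩, ?_⟩
    intro h
    have := congrArg Subtype.val h
    simp at this
  let g : {T : Set (V a1 a2) // T ⊆ S ∧
        ∀ x y, Arrow a1 a2 x y → x ∈ T → y ∈ S → y ∈ T} →
      {N : ∀ x : V a1 a2, Submodule k ((thinRep k S).carrier x) //
        IsSubrep (thinRep k S) N} := fun T => ⟨fun x => if x ∈ T.1 then ⊤ else ⊥, by
      intro x y h v hv
      by_cases hy : y ∈ T.1
      · simp [hy]
      · by_cases hx : x ∈ T.1
        · have hyS : y ∉ S := fun hS => hy (T.2.2 x y h hx hS)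
          have : (thinRep k S).map x y h v = 0 := by
            show thinMap k S S x y v = 0
            simp [thinMap, hyS]
          rw [this]
          exact Submodule.zero_mem _
        · have : v = 0 := by simpa [hx] using hv
          rw [this, map_zero]
          exact Submodule.zero_mem _⟩
  symm
  refine Nat.card_eq_of_bijective g ⟨?_, ?_⟩
  · intro T U h
    have h1 : ∀ x, (if x ∈ T.1 then (⊤ : Submodule k (sp k S x)) else ⊥) =
        (if x ∈ U.1 then (⊤ : Submodule k (sp k S x)) else ⊥) :=
      fun x => congrFun (congrArg Subtype.val h) x
    apply Subtype.ext
    ext x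
    have hx := h1 x
    have nt : x ∈ S → (⊤ : Submodule k (sp k S x)) ≠ ⊥ := by
      intro hS hb
      obtain ⟨v, hv⟩ := nz x hS
      apply hv
      have : v ∈ (⊤ : Submodule k (sp k S x)) := trivial
      rw [hb] at this
      simpa using this
    by_cases hT : x ∈ T.1 <;> by_cases hU : x ∈ U.1 <;> simp only [hT, hU, if_true, if_false] at hx ⊢
    · exact absurd hx (nt (T.2.1 hT))
    · exact absurd hx.symm (nt (U.2.1 hU))
  · rintro ⟨N, hN⟩
    refine ⟨⟨{x | ∃ v : sp k S x, v ∈ N x ∧ v ≠ 0}, ?_, ?_⟩, ?_⟩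
    · rintro x ⟨v, _, hv⟩
      exact supp x v hv
    · rintro x y h ⟨v, hv, hv0⟩ hy
      refine ⟨thinMap k S S x y v, hN x y h v hv, ?_⟩
      intro h0
      apply hv0
      have := congrArg Subtype.val h0
      simp [thinMap, hy] at this
      exact this
    · apply Subtype.ext
      funext x
      show (if (∃ v : sp k S x, v ∈ N x ∧ v ≠ 0) then (⊤ : Submodule k (sp k S x)) else ⊥) = N x
      split_ifs with h
      · obtain ⟨v, hv, hv0⟩ := h
        exact (eq_top_iff.2 fun w _ => key x (N x) v hv hv0 w).symm
      · symm
        refine (Submodule.eq_bot_iff _).2 fun v hv => ?_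
        by_contra hv0
        exact h ⟨v, hv, hv0⟩

theorem exCut (n : ℕ) (P : ℕ → Prop) (h : ∀ m, m + 1 < n → P m → P (m + 1)) :
    ∃ p, p ≤ n ∧ ∀ m, m < n → (P m ↔ p ≤ m) := by
  classical
  have hex : ∃ m, n ≤ m ∨ P m := ⟨n, Or.inl le_rfl⟩
  refine ⟨Nat.find hex, Nat.find_min' hex (Or.inl le_rfl), fun m hm => ⟨fun hP =>
    Nat.find_min' hex (Or.inr hP), fun hle => ?_⟩⟩
  induction m, hle using Nat.le_induction with
  | base => rcases Nat.find_spec hex with h1 | h1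
            · omega
            · exact h1
  | succ m hm' ih => exact h m hm (ih (by omega))

theorem cutUniq (n p p' : ℕ) (hp : p ≤ n) (hp' : p' ≤ n)
    (h : ∀ m, m < n → (p ≤ m ↔ p' ≤ m)) : p = p' := by
  by_contra hne
  rcases Nat.lt_or_gt_of_ne hne with h1 | h1
  · have := h p (by omega); omega
  · have := h p' (by omega); omega

def posR (a2 i j : ℕ) : ℕ := if i < j then j - i - 1 else j + (a2 - i)

def setT (a1 a2 i p q : ℕ) : Set (V a1 a2) :=
  {x | match x with
      | .r j => (j : ℕ) ≠ i ∧ p ≤ posR a2 i j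
      | .s j => p < a2 - i ∧ q ≤ (j : ℕ)
      | .t j => i ≠ 0 ∧ (p ≤ a2 - i ∨ q ≤ (j : ℕ))}

theorem setT_closed (a1 a2 i p q : ℕ) (ha1 : 0 < a1) (hi : i ≤ a2) :
    setT a1 a2 i p q ⊆ suppR a1 a2 i ∧
        ∀ x y, Arrow a1 a2 x y → x ∈ setT a1 a2 i p q → y ∈ suppR a1 a2 i →
          y ∈ setT a1 a2 i p q := by
  constructor
  · rintro (j | j | j) h <;> simp only [setT, suppR, Set.mem_ofPred_eq] at h ⊢ <;> omega
  · rintro (⟨j, hj⟩ | ⟨j, hj⟩ | ⟨j, hj⟩) (⟨l, hl⟩ | ⟨l, hl⟩ | ⟨l, hl⟩) ha h hS <;>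
      simp only [setT, suppR, Set.mem_ofPred_eq, Arrow, posR] at h hS ha ⊢ <;>
      (repeat' split_ifs at *) <;> omega

theorem setT_surj (a1 a2 i : ℕ) (ha1 : 0 < a1) (ha2 : 0 < a2) (hi : i ≤ a2)
    (T : Set (V a1 a2)) (hTS : T ⊆ suppR a1 a2 i)
    (hT : ∀ x y, Arrow a1 a2 x y → x ∈ T → y ∈ suppR a1 a2 i → y ∈ T) :
    ∃ p q, p ≤ a2 ∧ q < a1 ∧ (p = a2 - i → q = 0) ∧ T = setT a1 a2 i p q := by
  obtain ⟨p, hp, hpP⟩ := exCut a2 (fun m => ∃ j : Fin (a2 + 1), (j : ℕ) ≠ i ∧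
      posR a2 i j = m ∧ V.r j ∈ T) (by
    rintro m hm ⟨⟨j, hj⟩, hji, hjm, hjT⟩
    simp only [posR] at hji hjm
    by_cases hja : j = a2
    · refine ⟨⟨0, by omega⟩, ?_, ?_, hT _ _ ?_ hjT ?_⟩ <;>
        simp only [posR, Arrow, suppR, Set.mem_ofPred_eq] <;> split_ifs at * <;> first | omega | simp [hja]
    · refine ⟨⟨j + 1, by omega⟩, ?_, ?_, hT _ _ ?_ hjT ?_⟩ <;>
        simp only [posR, Arrow, suppR, Set.mem_ofPred_eq] <;> split_ifs at * <;> first | omega | simp [hja])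
  have hR : ∀ j : Fin (a2 + 1), V.r j ∈ T ↔ (j : ℕ) ≠ i ∧ p ≤ posR a2 i j := by
    intro j
    constructor
    · intro h
      have h1 : (j : ℕ) ≠ i := hTS h
      refine ⟨h1, (hpP _ ?_).1 ⟨j, h1, rfl, h⟩⟩
      have := j.2
      simp only [posR]; split_ifs <;> omega
    · rintro ⟨h1, h2⟩
      have hlt : posR a2 i j < a2 := by
        have := j.2
        simp only [posR]; split_ifs <;> omega
      obtain ⟨l, hl, hlj, hlT⟩ := (hpP _ hlt).2 h2
      have : l = j := by
        apply Fin.ext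
        have := j.2
        have := l.2
        simp only [posR] at hlj; split_ifs at hlj <;> omega
      rwa [← this]
  obtain ⟨qs, hqs, hsP⟩ := exCut (a1 - 1) (fun m => ∃ h : m < a1 - 1, V.s ⟨m, h⟩ ∈ T) (by
    rintro m hm ⟨h, hmT⟩
    refine ⟨hm, hT _ _ ?_ hmT ?_⟩
    · simp [Arrow]
    · exact (show i ≠ a2 from hTS hmT))
  obtain ⟨qt, hqt, htP⟩ := exCut (a1 - 1) (fun m => ∃ h : m < a1 - 1, V.t ⟨m, h⟩ ∈ T) (by
    rintro m hm ⟨h, hmT⟩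
    refine ⟨hm, hT _ _ ?_ hmT ?_⟩
    · simp [Arrow]
    · exact (show i ≠ 0 from hTS hmT))
  have hs : ∀ j : Fin (a1 - 1), V.s j ∈ T ↔ qs ≤ (j : ℕ) := fun j =>
    ⟨fun h => (hsP j j.2).1 ⟨j.2, h⟩, fun h => ((hsP j j.2).2 h).2⟩
  have ht : ∀ j : Fin (a1 - 1), V.t j ∈ T ↔ qt ≤ (j : ℕ) := fun j =>
    ⟨fun h => (htP j j.2).1 ⟨j.2, h⟩, fun h => ((htP j j.2).2 h).2⟩
  -- s nonempty forces p < a2 - i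
  have hs1 : ¬ p < a2 - i → qs = a1 - 1 := by
    intro hnp
    by_contra hne
    have h1 : V.s ⟨a1 - 2, by omega⟩ ∈ T := (hs ⟨a1 - 2, by omega⟩).2 (by simp only; omega)
    have h2 : i ≠ a2 := hTS h1
    have h3 : V.r ⟨a2, by omega⟩ ∈ T := hT _ _ (by simp [Arrow]) h1 (by
      simp only [suppR, Set.mem_ofPred_eq]; omega)
    have h4 := ((hR _).1 h3).2
    simp only [posR] at h4; split_ifs at h4 <;> omega
  have ht1 : p ≤ a2 - i → i ≠ 0 → qt = 0 := by
    intro hp0 hi0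
    by_contra hne
    have h3 : V.r ⟨0, by omega⟩ ∈ T := (hR _).2 (by
      simp only [posR]; split_ifs <;> omega)
    have h1 : V.t ⟨0, by omega⟩ ∈ T := hT _ _ (by simp [Arrow]) h3 hi0
    have := (ht _).1 h1
    simp only at this; omega
  have ht2 : i = 0 → qt = a1 - 1 := by
    intro hi0
    by_contra hne
    have h1 : V.t ⟨qt, by omega⟩ ∈ T := (ht _).2 le_rfl
    exact hTS h1 hi0
  refine ⟨p, if p < a2 - i then qs else if p = a2 - i then 0 else qt, hp, ?_, ?_, ?_⟩
  · split_ifs <;> omega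
  · intro h; simp [h]
  · ext (j | j | j)
    · rw [hR]; rfl
    · rw [hs]
      have := j.2
      simp only [setT, Set.mem_ofPred_eq]
      split_ifs <;> omega
    · rw [ht]
      have := j.2
      simp only [setT, Set.mem_ofPred_eq]
      split_ifs <;> omega

theorem setT_inj (a1 a2 i p q p' q' : ℕ) (ha1 : 0 < a1) (hi : i ≤ a2)
    (hp : p ≤ a2) (hp' : p' ≤ a2) (hq : q < a1) (hq' : q' < a1)
    (h0 : p = a2 - i → q = 0) (h0' : p' = a2 - i → q' = 0)
    (h : setT a1 a2 i p q = setT a1 a2 i p' q') : p = p' ∧ q = q' := by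
  have hm : ∀ x, x ∈ setT a1 a2 i p q ↔ x ∈ setT a1 a2 i p' q' := fun x => by rw [h]
  have hpp : p = p' := by
    refine cutUniq a2 p p' hp hp' fun m hm' => ?_
    by_cases hlt : m < a2 - i
    · have := hm (V.r ⟨i + 1 + m, by omega⟩)
      simp only [setT, Set.mem_ofPred_eq, posR] at this
      split_ifs at this <;> omega
    · have := hm (V.r ⟨m - (a2 - i), by omega⟩)
      simp only [setT, Set.mem_ofPred_eq, posR] at this
      split_ifs at this <;> omega
  refine ⟨hpp, ?_⟩
  subst hpp
  by_cases hpe : p = a2 - i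
  · rw [h0 hpe, h0' hpe]
  refine cutUniq (a1 - 1) q q' (by omega) (by omega) fun m hm' => ?_
  have h1 := hm (V.s ⟨m, hm'⟩)
  have h2 := hm (V.t ⟨m, hm'⟩)
  simp only [setT, Set.mem_ofPred_eq] at h1 h2
  omega

theorem statement0 (k : Type) [Field k] (a1 a2 : ℕ) (ha1 : 0 < a1) (ha2 : 0 < a2)
    (i : ℕ) (hi : i ≤ a2) :
    Nat.card {N : ∀ x : V a1 a2, Submodule k ((Mr k a1 a2 i).carrier x) //
        IsSubrep (Mr k a1 a2 i) N} = a1 * a2 + 1 := by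
  refine (cardThin k (suppR a1 a2 i)).trans ?_
  have hc : Nat.card (Option (Fin a1 × Fin a2)) = a1 * a2 + 1 := by simp
  rw [← hc]
  symm
  let P : Option (Fin a1 × Fin a2) → ℕ := fun o => match o with
    | none => a2 - i
    | some (_, p) => if (p : ℕ) < a2 - i then p else p + 1
  let Q : Option (Fin a1 × Fin a2) → ℕ := fun o => match o with
    | none => 0
    | some (q, _) => q
  have hP : ∀ o, P o ≤ a2 := by
    rintro (_ | ⟨q, p⟩)
    · simp [P]
    · have := p.2
      simp only [P]; split_ifs <;> omega
  have hQ : ∀ o, Q o < a1 := by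
    rintro (_ | ⟨q, p⟩)
    · simpa [Q]
    · simp [Q]
  have hPQ : ∀ o, P o = a2 - i → Q o = 0 := by
    rintro (_ | ⟨q, p⟩)
    · simp [Q]
    · intro h
      simp only [P] at h; split_ifs at h <;> omega
  refine Nat.card_eq_of_bijective (fun o => ⟨setT a1 a2 i (P o) (Q o),
    setT_closed a1 a2 i _ _ ha1 hi⟩) ⟨?_, ?_⟩
  · intro o o' h
    have h := setT_inj a1 a2 i _ _ _ _ ha1 hi (hP o) (hP o') (hQ o) (hQ o') (hPQ o) (hPQ o')
      (congrArg Subtype.val h)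
    rcases o with _ | ⟨q, p⟩ <;> rcases o' with _ | ⟨q', p'⟩
    · rfl
    · exfalso
      simp only [P] at h; split_ifs at h <;> omega
    · exfalso
      simp only [P] at h; split_ifs at h <;> omega
    · simp only [P, Q] at h
      have h1 : q = q' := Fin.ext h.2
      have h2 : p = p' := by
        apply Fin.ext
        split_ifs at h <;> omega
      rw [h1, h2]
  · rintro ⟨T, hTS, hT⟩
    obtain ⟨p, q, hp, hq, hpq, rfl⟩ := setT_surj a1 a2 i ha1 ha2 hi T hTS hT
    have : ∃ o, P o = p ∧ Q o = q := by
      rcases lt_trichotomy p (a2 - i) with h | h | h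
      · refine ⟨some (⟨q, hq⟩, ⟨p, by omega⟩), ?_, rfl⟩
        simp [P, h]
      · exact ⟨none, h.symm, (hpq h).symm⟩
      · refine ⟨some (⟨q, hq⟩, ⟨p - 1, by omega⟩), ?_, rfl⟩
        simp only [P]; split_ifs <;> omega
    obtain ⟨o, h1, h2⟩ := this
    refine ⟨o, Subtype.ext ?_⟩
    simp only [h1, h2]
end

section
/- For every i with 0 ≤ i ≤ a2, the number of subrepresentations N of M(r_i) satisfying N_{r_{a2}} ≠ 0 is exactly a1·(a2 − i). -/
lemma aux_bot_top {k : Type} [Field k] {a1 a2 : ℕ} (S : Set (V a1 a2)) (x : V a1 a2)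
    (N : Submodule k ((thinRep k S).carrier x)) : N = ⊥ ∨ N = ⊤ := by
  change Submodule k ↥(sp k S x) at N
  change N = ⊥ ∨ N = ⊤
  by_cases h : N = ⊥
  · exact Or.inl h
  · right
    obtain ⟨v, hv, hv0⟩ := (Submodule.ne_bot_iff N).1 h
    have hv1 : (v : k) ≠ 0 := fun h => hv0 (Subtype.ext h)
    rw [eq_top_iff]
    intro w _
    have : w = ((w : k) / (v : k)) • v := by
      apply Subtype.ext
      simp [hv1]
    rw [this]
    exact N.smul_mem _ hv

lemma aux_out {k : Type} [Field k] {a1 a2 : ℕ} {S : Set (V a1 a2)} {x : V a1 a2} (hx : x ∉ S)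
    (N N' : Submodule k ((thinRep k S).carrier x)) : N = N' := by
  have : Subsingleton ((thinRep k S).carrier x) := by
    change Subsingleton ↥(sp k S x)
    simp only [sp, if_neg hx]
    infer_instance
  exact Subsingleton.elim _ _

lemma aux_ne {k : Type} [Field k] {a1 a2 : ℕ} {S : Set (V a1 a2)} {x : V a1 a2} (hx : x ∈ S) :
    (⊤ : Submodule k ((thinRep k S).carrier x)) ≠ ⊥ := by
  have : Nontrivial ((thinRep k S).carrier x) := by
    change Nontrivial ↥(sp k S x)
    exact ⟨⟨⟨1, by simp [sp, hx]⟩, 0, fun h => one_ne_zero (congrArg Subtype.val h)⟩⟩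
  exact top_ne_bot

lemma aux_sub {k : Type} [Field k] {a1 a2 : ℕ} (S : Set (V a1 a2))
    (N : ∀ x, Submodule k ((thinRep k S).carrier x)) :
    IsSubrep (thinRep k S) N ↔
      ∀ x y, Arrow a1 a2 x y → x ∈ S → y ∈ S → N x = ⊤ → N y = ⊤ := by
  constructor
  · intro h x y hxy hx hy hN
    rcases aux_bot_top S y (N y) with hb | ht
    · exfalso
      have h1 := h x y hxy (⟨1, by simp [sp, hx]⟩ : ↥(sp k S x)) (by rw [hN]; trivial)
      rw [hb] at h1
      have h2 : thinMap k S S x y ⟨1, by simp [sp, hx]⟩ = 0 := h1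
      simp only [thinMap, LinearMap.coe_mk, AddHom.coe_mk, dif_pos hy] at h2
      have := congrArg Subtype.val h2
      simp at this
    · exact ht
  · intro h x y hxy v hv
    by_cases hy : y ∈ S
    · by_cases hx : x ∈ S
      · rcases aux_bot_top S x (N x) with hb | ht
        · rw [hb] at hv
          have : v = 0 := hv
          rw [this, map_zero]
          exact (N y).zero_mem
        · rw [h x y hxy hx hy ht]; trivial
      · rw [aux_out hx (N x) ⊥] at hv
        have : v = 0 := hv
        rw [this, map_zero]
        exact (N y).zero_mem
    · rw [aux_out hy (N y) ⊤]; trivial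

lemma aux_thr (P : ℕ → Prop) (lo hi : ℕ) (hlh : lo ≤ hi)
    (hP : ∀ j, lo ≤ j → j < hi → P j → P (j + 1)) (h : P hi) :
    ∃ c, lo ≤ c ∧ c ≤ hi ∧ ∀ j, lo ≤ j → j ≤ hi → (P j ↔ c ≤ j) := by
  classical
  have hex : ∃ c, lo ≤ c ∧ P c := ⟨hi, hlh, h⟩
  obtain ⟨h1, h2⟩ := Nat.find_spec hex
  refine ⟨Nat.find hex, h1, Nat.find_min' hex ⟨hlh, h⟩, fun j hj hj' => ⟨fun hp => Nat.find_min' hex ⟨hj, hp⟩, fun hc => ?_⟩⟩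
  induction j, hc using Nat.le_induction with
  | base => exact h2
  | succ n hn ih => exact hP n (by omega) (by omega) (ih (by omega) (by omega))

def auxU (a1 a2 i p q : ℕ) : V a1 a2 → Prop
  | .r j => (j : ℕ) < i ∨ i + 1 + q ≤ (j : ℕ)
  | .s j => p ≤ (j : ℕ)
  | .t _ => True

open Classical in
noncomputable def auxF (k : Type) [Field k] (a1 a2 i p q : ℕ) (x : V a1 a2) :
    Submodule k ((thinRep k (suppR a1 a2 i)).carrier x) :=
  if auxU a1 a2 i p q x then ⊤ else ⊥

lemma auxF_top {k : Type} [Field k] {a1 a2 i p q : ℕ} {x : V a1 a2} (hx : x ∈ suppR a1 a2 i) :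
    auxF k a1 a2 i p q x = ⊤ ↔ auxU a1 a2 i p q x := by
  unfold auxF
  split_ifs with h
  · simp [h]
  · simp only [h, iff_false]
    exact (aux_ne hx).symm

lemma aux_eq {k : Type} [Field k] {a1 a2 : ℕ} {S : Set (V a1 a2)}
    {N N' : ∀ x, Submodule k ((thinRep k S).carrier x)}
    (h : ∀ x ∈ S, (N x = ⊤ ↔ N' x = ⊤)) : N = N' := by
  funext x
  by_cases hx : x ∈ S
  · have := h x hx
    rcases aux_bot_top S x (N x) with h1 | h1 <;> rcases aux_bot_top S x (N' x) with h2 | h2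
    · rw [h1, h2]
    · exact (this.2 h2).trans h2.symm
    · exact h1.trans (this.1 h1).symm
    · rw [h1, h2]
  · exact aux_out hx _ _

lemma auxF_sub (k : Type) [Field k] (a1 a2 i p q : ℕ) (hq : q < a2 - i) :
    IsSubrep (thinRep k (suppR a1 a2 i)) (auxF k a1 a2 i p q) := by
  rw [aux_sub]
  intro x y hxy hx hy h
  rw [auxF_top hx] at h
  rw [auxF_top hy]
  rcases x with x | x | x <;> rcases y with y | y | y <;>
    simp only [Arrow, auxU, suppR, Set.mem_ofPred_eq] at * <;> omega

theorem statement1 (k : Type) [Field k] (a1 a2 : ℕ) (ha1 : 0 < a1) (ha2 : 0 < a2)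
    (i : ℕ) (hi : i ≤ a2) :
    Nat.card {N : ∀ x : V a1 a2, Submodule k ((Mr k a1 a2 i).carrier x) //
        IsSubrep (Mr k a1 a2 i) N ∧ N (V.r (Fin.last a2)) ≠ ⊥} = a1 * (a2 - i) := by
  unfold Mr
  have hlast : ∀ q : Fin (a2 - i), V.r (Fin.last a2) ∈ suppR a1 a2 i := by
    intro q
    have := q.2
    simp only [suppR, Set.mem_ofPred_eq, Fin.val_last]
    omega
  let F : Fin a1 × Fin (a2 - i) →
      {N : ∀ x : V a1 a2, Submodule k ((thinRep k (suppR a1 a2 i)).carrier x) //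
        IsSubrep (thinRep k (suppR a1 a2 i)) N ∧ N (V.r (Fin.last a2)) ≠ ⊥} :=
    fun pq => ⟨auxF k a1 a2 i pq.1 pq.2, auxF_sub k a1 a2 i _ _ pq.2.2, by
      have h : auxF k a1 a2 i pq.1 pq.2 (V.r (Fin.last a2)) = ⊤ := by
        rw [auxF_top (hlast pq.2)]
        have := pq.2.2
        simp only [auxU, Fin.val_last]
        omega
      rw [h]
      exact aux_ne (hlast pq.2)⟩
  have hF : Function.Bijective F := by
    constructor
    · rintro ⟨p, q⟩ ⟨p', q'⟩ h
      have h1 : auxF k a1 a2 i p q = auxF k a1 a2 i p' q' := congrArg Subtype.val h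
      have hU : ∀ x ∈ suppR a1 a2 i, (auxU a1 a2 i p q x ↔ auxU a1 a2 i p' q' x) := by
        intro x hx
        rw [← auxF_top (k := k) hx, ← auxF_top (k := k) hx, h1]
      have hp := p.2
      have hp' := p'.2
      have hq := q.2
      have hq' := q'.2
      have hs : ∀ j : ℕ, j < a1 - 1 → ((p : ℕ) ≤ j ↔ (p' : ℕ) ≤ j) := fun j hj =>
        hU (V.s ⟨j, hj⟩) (by simp only [suppR, Set.mem_ofPred_eq]; omega)
      have hr : ∀ j : ℕ, i < j → j < a2 + 1 →
          ((j < i ∨ i + 1 + (q : ℕ) ≤ j) ↔ (j < i ∨ i + 1 + (q' : ℕ) ≤ j)) := fun j hij hj =>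
        hU (V.r ⟨j, hj⟩) (by simp only [suppR, Set.mem_ofPred_eq]; omega)
      have e1 : (p : ℕ) = p' := by
        have := hs p
        have := hs p'
        omega
      have e2 : (q : ℕ) = q' := by
        have := hr (i + 1 + q) (by omega) (by omega)
        have := hr (i + 1 + q') (by omega) (by omega)
        omega
      exact Prod.ext (Fin.ext e1) (Fin.ext e2)
    · rintro ⟨N, hN, hne⟩
      rw [aux_sub] at hN
      have hl : N (V.r (Fin.last a2)) = ⊤ := (aux_bot_top _ _ _).resolve_left hne
      have hlt : i < a2 := by
        rcases hi.lt_or_eq with h | h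
        · exact h
        · exfalso
          apply hne
          apply aux_out
          simp [suppR, h]
      obtain ⟨p, -, hp2, hp⟩ := aux_thr (fun j => ∀ h : j < a1 - 1, N (V.s ⟨j, h⟩) = ⊤) 0 (a1 - 1)
        (by omega) (by
          intro j _ hj hP h
          refine hN _ _ ?_ ?_ ?_ (hP hj) <;> simp [Arrow, suppR] <;> omega)
        (fun h => absurd h (lt_irrefl _))
      obtain ⟨c, hc1, hc2, hc⟩ := aux_thr (fun j => ∀ h : j < a2 + 1, N (V.r ⟨j, h⟩) = ⊤)
        (i + 1) a2 (by omega) (by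
          intro j hj hj' hP h
          refine hN _ _ ?_ ?_ ?_ (hP (by omega)) <;> simp [Arrow, suppR] <;> omega)
        (fun _ => hl)
      have hr0 : ∀ j : ℕ, j < i → ∀ h : j < a2 + 1, N (V.r ⟨j, h⟩) = ⊤ := by
        intro j
        induction j with
        | zero =>
          intro hj h
          refine hN _ _ ?_ ?_ ?_ hl <;> simp [Arrow, suppR] <;> omega
        | succ n ih =>
          intro hj h
          refine hN _ _ ?_ ?_ ?_ (ih (by omega) (by omega)) <;> simp [Arrow, suppR] <;> omega
      have ht : 0 < i → ∀ j : ℕ, ∀ h : j < a1 - 1, N (V.t ⟨j, h⟩) = ⊤ := by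
        intro hi0 j
        induction j with
        | zero =>
          intro h
          refine hN _ _ ?_ ?_ ?_ (hr0 0 hi0 (by omega)) <;> simp [Arrow, suppR] <;> omega
        | succ n ih =>
          intro h
          refine hN _ _ ?_ ?_ ?_ (ih (by omega)) <;> simp [Arrow, suppR] <;> omega
      refine ⟨(⟨p, by omega⟩, ⟨c - (i + 1), by omega⟩), Subtype.ext (aux_eq ?_)⟩
      intro x hx
      refine (auxF_top hx).trans ?_
      rcases x with ⟨j, hj⟩ | ⟨j, hj⟩ | ⟨j, hj⟩
      · simp only [suppR, Set.mem_ofPred_eq] at hx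
        simp only [auxU]
        by_cases hji : j < i
        · simp [hji, hr0 j hji hj]
        · have := hc j (by omega) (by omega)
          simp only [hj, forall_true_left] at this
          rw [this]
          omega
      · have := hp j (by omega) (by omega)
        simp only [hj, forall_true_left] at this
        rw [this]
        rfl
      · simp only [suppR, Set.mem_ofPred_eq] at hx
        simp only [auxU, true_iff]
        exact ht (by omega) j hj
  rw [← Nat.card_eq_of_bijective F hF]
  simp
end

section
/- For every i with 1 ≤ i ≤ a2, the representation M(r_i) has exactly one subrepresentation N satisfying N_{r_0} ≠ 0 and N_{r_{a2}} = 0. -/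
theorem sp_zero (k : Type) [Field k] {a1 a2 : ℕ} (S : Set (V a1 a2)) (x : V a1 a2)
    (hx : x ∉ S) (v : sp k S x) : v = 0 := by
  obtain ⟨v, hv⟩ := v
  have : v = 0 := by simpa [sp, hx] using hv
  exact Subtype.ext this

theorem thin_coe (k : Type) [Field k] {a1 a2 : ℕ} (S : Set (V a1 a2)) (x y : V a1 a2)
    (hy : y ∈ S) (v : sp k S x) : ((thinMap k S S x y v : sp k S y) : k) = v := by
  simp [thinMap, hy]

theorem sp_top (k : Type) [Field k] {a1 a2 : ℕ} (S : Set (V a1 a2)) (x : V a1 a2)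
    (P : Submodule k (sp k S x)) (hP : P ≠ ⊥) : P = ⊤ := by
  obtain ⟨v, hv, h0⟩ := Submodule.exists_mem_ne_zero_of_ne_bot hP
  rw [Submodule.eq_top_iff']
  intro w
  have h0' : (v : k) ≠ 0 := fun h => h0 (Subtype.ext h)
  have : w = ((w : k) * (v : k)⁻¹) • v := by
    apply Subtype.ext
    simp [h0']
  rw [this]
  exact P.smul_mem _ hv

theorem thin_up (k : Type) [Field k] {a1 a2 : ℕ} (S : Set (V a1 a2))
    (N : ∀ x, Submodule k (sp k S x)) (hN : IsSubrep (thinRep k S) N) (x y : V a1 a2)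
    (h : Arrow a1 a2 x y) (hx : x ∈ S) (ht : N x = ⊤) : N y = ⊤ := by
  by_cases hy : y ∈ S
  · apply sp_top
    intro hb
    have h1 := hN x y h (⟨1, by simp [sp, hx]⟩ : sp k S x) (by rw [ht]; trivial)
    have h2 : thinMap k S S x y ⟨1, by simp [sp, hx]⟩ ∈ N y := h1
    rw [hb, Submodule.mem_bot] at h2
    have h3 := thin_coe k S x y hy ⟨1, by simp [sp, hx]⟩
    rw [h2] at h3
    simp at h3
  · rw [Submodule.eq_top_iff']
    intro w
    rw [sp_zero k S y hy w]
    exact zero_mem _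

theorem thin_down (k : Type) [Field k] {a1 a2 : ℕ} (S : Set (V a1 a2))
    (N : ∀ x, Submodule k (sp k S x)) (hN : IsSubrep (thinRep k S) N) (x y : V a1 a2)
    (h : Arrow a1 a2 x y) (hy : y ∈ S) (hb : N y = ⊥) : N x = ⊥ := by
  rw [Submodule.eq_bot_iff]
  intro v hv
  have h2 : thinMap k S S x y v ∈ N y := hN x y h v hv
  rw [hb, Submodule.mem_bot] at h2
  have h3 := thin_coe k S x y hy v
  rw [h2] at h3
  exact Subtype.ext h3.symm

theorem thin_bot (k : Type) [Field k] {a1 a2 : ℕ} (S : Set (V a1 a2))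
    (N : ∀ x, Submodule k (sp k S x)) (x : V a1 a2) (hx : x ∉ S) : N x = ⊥ := by
  rw [Submodule.eq_bot_iff]
  intro v _
  exact sp_zero k S x hx v

open Classical in
noncomputable def theN (k : Type) [Field k] (a1 a2 i : ℕ) :
    ∀ x : V a1 a2, Submodule k (sp k (suppR a1 a2 i) x)
  | .r j => if (j : ℕ) < i then ⊤ else ⊥
  | .s _ => ⊥
  | .t _ => ⊤

theorem theN_sub (k : Type) [Field k] (a1 a2 i : ℕ) (hi1 : 1 ≤ i) :
    IsSubrep (Mr k a1 a2 i) (theN k a1 a2 i) := by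
  intro x y h v hv
  change sp k (suppR a1 a2 i) x at v
  change thinMap k _ _ x y v ∈ theN k a1 a2 i y
  change v ∈ theN k a1 a2 i x at hv
  by_cases hy : y ∈ suppR a1 a2 i
  swap
  · rw [sp_zero k _ y hy (thinMap k _ _ x y v)]
    exact zero_mem _
  by_cases hb : theN k a1 a2 i x = ⊥
  · rw [hb, Submodule.mem_bot] at hv
    rw [hv, map_zero]
    exact zero_mem _
  have : theN k a1 a2 i y = ⊤ := by
    cases x with
    | r j =>
      have hj : (j : ℕ) < i := by
        by_contra hj
        exact hb (by simp [theN, hj])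
      cases y with
      | r l =>
        have hl : (l : ℕ) ≠ i := hy
        have h' : ((j : ℕ) + 1 = (l : ℕ)) ∨ ((j : ℕ) = a2 ∧ (l : ℕ) = 0) := h
        have : (l : ℕ) < i := by omega
        simp [theN, this]
      | s l => exact h.elim
      | t l => rfl
    | s j => exact (hb rfl).elim
    | t j =>
      cases y with
      | r l => exact h.elim
      | s l => exact h.elim
      | t l => rfl
  rw [this]
  trivial

theorem uniq (k : Type) [Field k] (a1 a2 : ℕ) (i : ℕ) (hi1 : 1 ≤ i) (hi2 : i ≤ a2)
    (N : ∀ x : V a1 a2, Submodule k (sp k (suppR a1 a2 i) x))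
    (hN : IsSubrep (thinRep k (suppR a1 a2 i)) N)
    (h0 : N (V.r 0) ≠ ⊥) (hl : N (V.r (Fin.last a2)) = ⊥) : N = theN k a1 a2 i := by
  have h0' := sp_top k _ _ _ h0
  have up : ∀ j : ℕ, ∀ hj : j < a2 + 1, j < i → N (V.r ⟨j, hj⟩) = ⊤ := by
    intro j
    induction j with
    | zero => intro _ _; exact h0'
    | succ j ih =>
      intro hj hji
      refine thin_up k _ N hN (V.r ⟨j, by omega⟩) _ (Or.inl rfl) ?_ (ih _ (by omega))
      change j ≠ i
      omega
  have down : ∀ d : ℕ, ∀ j : ℕ, ∀ hj : j < a2 + 1, j + d = a2 → i < j →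
      N (V.r ⟨j, hj⟩) = ⊥ := by
    intro d
    induction d with
    | zero =>
      intro j hj hd _
      have : (⟨j, hj⟩ : Fin (a2 + 1)) = Fin.last a2 := Fin.ext (by simpa using hd)
      rw [this]; exact hl
    | succ d ih =>
      intro j hj hd hij
      refine thin_down k _ N hN _ (V.r ⟨j + 1, by omega⟩) (Or.inl rfl) ?_
        (ih _ _ (by omega) (by omega))
      change j + 1 ≠ i
      omega
  have tt : ∀ j : ℕ, ∀ hj : j < a1 - 1, N (V.t ⟨j, hj⟩) = ⊤ := by
    intro j
    induction j with
    | zero =>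
      intro hj
      refine thin_up k _ N hN (V.r 0) _ ⟨rfl, rfl⟩ ?_ h0'
      change 0 ≠ i
      omega
    | succ j ih =>
      intro hj
      refine thin_up k _ N hN (V.t ⟨j, by omega⟩) _ rfl ?_ (ih _)
      change i ≠ 0
      omega
  have ss : i ≠ a2 → ∀ d j : ℕ, ∀ hj : j < a1 - 1, j + d = a1 - 2 →
      N (V.s ⟨j, hj⟩) = ⊥ := by
    intro hne d
    induction d with
    | zero =>
      intro j hj hd
      refine thin_down k _ N hN _ (V.r (Fin.last a2)) ⟨hd, rfl⟩ ?_ hl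
      change a2 ≠ i
      omega
    | succ d ih =>
      intro j hj hd
      exact thin_down k _ N hN _ (V.s ⟨j + 1, by omega⟩) rfl hne (ih _ _ (by omega))
  funext x
  cases x with
  | r j =>
    obtain ⟨j, hj⟩ := j
    by_cases hji : j < i
    · rw [up j hj hji]; simp [theN, hji]
    · have : N (V.r ⟨j, hj⟩) = ⊥ := by
        by_cases he : j = i
        · exact thin_bot k _ N _ (fun h => h he)
        · exact down (a2 - j) j hj (by omega) (by omega)
      rw [this]; simp [theN, hji]
  | s j =>
    obtain ⟨j, hj⟩ := j
    change _ = ⊥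
    by_cases he : i = a2
    · exact thin_bot k _ N _ (fun h => h he)
    · exact ss he (a1 - 2 - j) j hj (by omega)
  | t j => exact tt j.1 j.2

/-- For every `i` with `1 ≤ i ≤ a2`, the representation `M(r_i)` has exactly one
subrepresentation `N` with `N_{r_0} ≠ 0` and `N_{r_{a2}} = 0`. -/
theorem statement2 (k : Type) [Field k] (a1 a2 : ℕ) (ha1 : 0 < a1) (ha2 : 0 < a2)
    (i : ℕ) (hi1 : 1 ≤ i) (hi2 : i ≤ a2) :
    ∃! N : ∀ x : V a1 a2, Submodule k ((Mr k a1 a2 i).carrier x),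
      IsSubrep (Mr k a1 a2 i) N ∧ N (V.r 0) ≠ ⊥ ∧ N (V.r (Fin.last a2)) = ⊥ := by
  refine ⟨theN k a1 a2 i, ⟨theN_sub k a1 a2 i hi1, ?_, ?_⟩, ?_⟩
  · change theN k a1 a2 i (V.r 0) ≠ ⊥
    intro h
    have ht : theN k a1 a2 i (V.r 0) = ⊤ := by
      have : 0 < i := hi1
      simp [theN, this]
    have hm : (V.r 0 : V a1 a2) ∈ suppR a1 a2 i := by
      change 0 ≠ i
      omega
    have h1 : (⟨1, by simp [sp, hm]⟩ : sp k (suppR a1 a2 i) (V.r 0)) ∈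
        theN k a1 a2 i (V.r 0) := by rw [ht]; trivial
    rw [h, Submodule.mem_bot] at h1
    exact one_ne_zero (congrArg Subtype.val h1)
  · change theN k a1 a2 i (V.r (Fin.last a2)) = ⊥
    have : ¬ a2 < i := by omega
    simp [theN, this]
  · rintro N ⟨hN, h0, hl⟩
    exact uniq k a1 a2 i hi1 hi2 N hN h0 hl
end

section
/- For every i with 1 ≤ i ≤ a2, the number of subrepresentations N of M(r_i) satisfying N_{r_0} = 0 and N_{r_{a2}} = 0 is exactly i·a1. -/
theorem sp_bot_or_top {k : Type} [Field k] {a1 a2 : ℕ} {S : Set (V a1 a2)} {x : V a1 a2}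
    (N : Submodule k (sp k S x)) (h : N ≠ ⊥) : N = ⊤ := by
  obtain ⟨v, hv, hv0⟩ := (Submodule.ne_bot_iff N).1 h
  rw [eq_top_iff]
  intro w _
  have hv1 : (v : k) ≠ 0 := fun e => hv0 (Subtype.ext e)
  have : w = ((w : k) / (v : k)) • v := by
    apply Subtype.ext
    simp [hv1]
  rw [this]
  exact N.smul_mem _ hv

theorem sp_eq_bot {k : Type} [Field k] {a1 a2 : ℕ} {S : Set (V a1 a2)} {x : V a1 a2}
    (hx : x ∉ S) (N : Submodule k (sp k S x)) : N = ⊥ := by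
  rw [eq_bot_iff]
  rintro ⟨v, hv⟩ _
  have hv' := hv
  simp only [sp, if_neg hx, Submodule.mem_bot] at hv'
  subst hv'
  simp

theorem sp_bot_ne_top {k : Type} [Field k] {a1 a2 : ℕ} {S : Set (V a1 a2)} {x : V a1 a2}
    (hx : x ∈ S) : (⊥ : Submodule k (sp k S x)) ≠ ⊤ := by
  intro h
  have h1 : (⟨1, by simp [sp, hx]⟩ : sp k S x) ∈ (⊤ : Submodule k (sp k S x)) := trivial
  rw [← h, Submodule.mem_bot] at h1
  exact one_ne_zero (congrArg Subtype.val h1)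

theorem isSubrep_iff {k : Type} [Field k] {a1 a2 : ℕ} {S : Set (V a1 a2)}
    (N : ∀ x : V a1 a2, Submodule k (sp k S x)) :
    IsSubrep (thinRep k S) N ↔ ∀ x y, Arrow a1 a2 x y → N x ≠ ⊥ → y ∈ S → N y = ⊤ := by
  constructor
  · intro h x y ha hx hy
    obtain ⟨v, hv, hv0⟩ := (Submodule.ne_bot_iff (N x)).1 hx
    apply sp_bot_or_top
    rw [Submodule.ne_bot_iff]
    have hm : thinMap k S S x y v ∈ N y := h x y ha v hv
    refine ⟨_, hm, fun e => hv0 ?_⟩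
    have e' := congrArg Subtype.val e
    simp only [thinMap, LinearMap.coe_mk, AddHom.coe_mk, dif_pos hy] at e'
    exact Subtype.ext e'
  · intro h x y ha (v : sp k S x) (hv : v ∈ N x)
    change thinMap k S S x y v ∈ N y
    by_cases hy : y ∈ S
    · by_cases hx : N x = ⊥
      · have hv' : v ∈ N x := hv
        rw [hx, Submodule.mem_bot] at hv'
        have : thinMap k S S x y v = 0 := by rw [hv']; exact map_zero _
        rw [this]; exact zero_mem _
      · rw [h x y ha hx hy]; trivial
    · have : thinMap k S S x y v = 0 := by
        simp [thinMap, dif_neg hy]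
      rw [this]; exact zero_mem _

def FF (a1 a2 i p q : ℕ) : V a1 a2 → Prop
  | .r j => p < (j : ℕ) ∧ (j : ℕ) < i
  | .s _ => False
  | .t j => q ≤ (j : ℕ)

open Classical in
noncomputable def NN (k : Type) [Field k] (a1 a2 i p q : ℕ) (x : V a1 a2) :
    Submodule k (sp k (suppR a1 a2 i) x) := if FF a1 a2 i p q x then ⊤ else ⊥

theorem NN_bot {k : Type} [Field k] {a1 a2 i p q : ℕ} {x : V a1 a2}
    (h : ¬ FF a1 a2 i p q x) : NN k a1 a2 i p q x = ⊥ := by simp [NN, h]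

theorem NN_top {k : Type} [Field k] {a1 a2 i p q : ℕ} {x : V a1 a2}
    (h : FF a1 a2 i p q x) : NN k a1 a2 i p q x = ⊤ := by simp [NN, h]

theorem FF_supp {a1 a2 i p q : ℕ} (hi : 1 ≤ i) {x : V a1 a2}
    (h : FF a1 a2 i p q x) : x ∈ suppR a1 a2 i := by
  cases x <;> simp only [FF, suppR, Set.mem_ofPred_eq] at * <;> omega

theorem FF_iff_of_NN {k : Type} [Field k] {a1 a2 i p q p' q' : ℕ} (hi : 1 ≤ i)
    (h : NN k a1 a2 i p q = NN k a1 a2 i p' q') (x : V a1 a2) :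
    FF a1 a2 i p q x ↔ FF a1 a2 i p' q' x := by
  have hx := congrFun h x
  constructor
  · intro h1
    by_contra h2
    rw [NN_top h1, NN_bot h2] at hx
    exact sp_bot_ne_top (FF_supp hi h1) hx.symm
  · intro h1
    by_contra h2
    rw [NN_top h1, NN_bot h2] at hx
    exact sp_bot_ne_top (FF_supp hi h1) hx

theorem NN_sub {k : Type} [Field k] {a1 a2 i p q : ℕ} (hi2 : i ≤ a2) :
    IsSubrep (thinRep k (suppR a1 a2 i)) (NN k a1 a2 i p q) := by
  rw [isSubrep_iff]
  intro x y ha hx hy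
  have hF : FF a1 a2 i p q x := by
    by_contra h
    exact hx (NN_bot h)
  apply NN_top
  cases x <;> cases y <;> simp only [FF, suppR, Set.mem_ofPred_eq, Arrow] at * <;> omega

/-- threshold of an up-closed predicate -/
theorem threshold (P : ℕ → Prop) (n : ℕ) (hP : ∀ j, j + 1 < n → P j → P (j + 1)) :
    ∃ q, q ≤ n ∧ ∀ j, j < n → (P j ↔ q ≤ j) := by
  classical
  induction n with
  | zero => exact ⟨0, le_rfl, by intro j hj; omega⟩
  | succ n ih =>
    obtain ⟨q, hq, h⟩ := ih (fun j hj => hP j (by omega))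
    by_cases hn : P n
    · refine ⟨q, by omega, fun j hj => ?_⟩
      rcases Nat.lt_succ_iff_lt_or_eq.1 hj with h1 | h1
      · exact h j h1
      · subst h1; exact ⟨fun _ => hq, fun _ => hn⟩
    · refine ⟨n + 1, le_rfl, fun j hj => ⟨fun hj' => ?_, fun h' => by omega⟩⟩
      exfalso
      rcases Nat.lt_succ_iff_lt_or_eq.1 hj with h1 | h1
      · have h2 : P (n - 1) := (h (n - 1) (by omega)).2 (by have := (h j h1).1 hj'; omega)
        have h3 := hP (n - 1) (by omega) h2
        rw [show n - 1 + 1 = n by omega] at h3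
        exact hn h3
      · subst h1; exact hn hj'

theorem NN_surj {k : Type} [Field k] {a1 a2 i : ℕ} (ha1 : 0 < a1) (hi1 : 1 ≤ i) (hi2 : i ≤ a2)
    (N : ∀ x : V a1 a2, Submodule k (sp k (suppR a1 a2 i) x))
    (hN : IsSubrep (thinRep k (suppR a1 a2 i)) N) (h0 : N (V.r 0) = ⊥)
    (hl : N (V.r (Fin.last a2)) = ⊥) :
    ∃ p q, p < i ∧ q < a1 ∧ NN k a1 a2 i p q = N := by
  rw [isSubrep_iff] at hN
  have step : ∀ x y, Arrow a1 a2 x y → N x ≠ ⊥ → y ∈ suppR a1 a2 i → N y ≠ ⊥ := by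
    intro x y ha hx hy
    rw [hN x y ha hx hy]
    exact (sp_bot_ne_top hy).symm
  obtain ⟨p, hp, hpP⟩ := threshold (fun j => ∃ h : j + 1 < a2 + 1, N (V.r ⟨j + 1, h⟩) ≠ ⊥) (i - 1)
    (by
      rintro j hj ⟨h, hx⟩
      refine ⟨by omega, step _ _ ?_ hx ?_⟩
      · simp [Arrow]
      · simp only [suppR, Set.mem_ofPred_eq]; omega)
  obtain ⟨q, hq, hqP⟩ := threshold (fun j => ∃ h : j < a1 - 1, N (V.t ⟨j, h⟩) ≠ ⊥) (a1 - 1)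
    (by
      rintro j hj ⟨h, hx⟩
      refine ⟨by omega, step _ _ ?_ hx ?_⟩
      · simp [Arrow]
      · simp only [suppR, Set.mem_ofPred_eq]; omega)
  -- vertices after r_i
  have hhigh : ∀ d j : ℕ, (hj : j < a2 + 1) → j + d = a2 → i ≤ j → N (V.r ⟨j, hj⟩) = ⊥ := by
    intro d
    induction d with
    | zero =>
      intro j hj h _
      have : (⟨j, hj⟩ : Fin (a2 + 1)) = Fin.last a2 := Fin.ext (by simpa using h)
      rw [this]; exact hl
    | succ d ih =>
      intro j hj h hij
      by_contra hne
      refine step (V.r ⟨j, hj⟩) (V.r ⟨j + 1, by omega⟩) ?_ hne ?_ (ih (j + 1) (by omega) (by omega) (by omega))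
      · simp [Arrow]
      · simp only [suppR, Set.mem_ofPred_eq]; omega
  have hs : ∀ d j : ℕ, (hj : j < a1 - 1) → j + d = a1 - 2 → N (V.s ⟨j, hj⟩) = ⊥ := by
    by_cases hia : i = a2
    · intro d j hj _
      apply sp_eq_bot
      simp only [suppR, Set.mem_ofPred_eq]; omega
    intro d
    induction d with
    | zero =>
      intro j hj h
      by_contra hne
      refine step (V.s ⟨j, hj⟩) (V.r (Fin.last a2)) ?_ hne ?_ hl
      · exact ⟨by simpa using h, by simp⟩
      · simp only [suppR, Set.mem_ofPred_eq, Fin.val_last]; omega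
    | succ d ih =>
      intro j hj h
      by_contra hne
      refine step (V.s ⟨j, hj⟩) (V.s ⟨j + 1, by omega⟩) ?_ hne ?_ (ih (j + 1) (by omega) (by omega))
      · simp [Arrow]
      · simp only [suppR, Set.mem_ofPred_eq]; omega
  refine ⟨p, q, by omega, by omega, ?_⟩
  have key : ∀ x, N x ≠ ⊥ ↔ FF a1 a2 i p q x := by
    rintro (⟨j, hj⟩ | ⟨j, hj⟩ | ⟨j, hj⟩)
    · rcases j with _ | j
      · simp only [FF]
        exact ⟨fun h => absurd h0 h, fun h => by omega⟩
      · simp only [FF]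
        by_cases hji : i ≤ j + 1
        · exact ⟨fun h => absurd (hhigh (a2 - (j + 1)) _ hj (by omega) hji) h, fun h => by omega⟩
        · have := hpP j (by omega)
          constructor
          · intro h
            have := this.1 ⟨hj, h⟩
            omega
          · intro h
            exact (this.2 (by omega)).2
    · simp only [FF, iff_false, not_not]
      exact hs (a1 - 2 - j) j hj (by omega)
    · simp only [FF]
      have := hqP j hj
      exact ⟨fun h => this.1 ⟨hj, h⟩, fun h => (this.2 h).2⟩
  funext x
  by_cases hx : N x = ⊥
  · rw [hx]; exact NN_bot (fun h => (key x).2 h hx)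
  · rw [sp_bot_or_top _ hx]; exact NN_top ((key x).1 hx)

/-- For every `i` with `1 ≤ i ≤ a2`, the number of subrepresentations `N` of
`M(r_i)` with `N_{r_0} = 0` and `N_{r_{a2}} = 0` is exactly `i * a1`. -/
theorem statement3 (k : Type) [Field k] (a1 a2 : ℕ) (ha1 : 0 < a1) (ha2 : 0 < a2)
    (i : ℕ) (hi1 : 1 ≤ i) (hi2 : i ≤ a2) :
    Nat.card {N : ∀ x : V a1 a2, Submodule k ((Mr k a1 a2 i).carrier x) //
        IsSubrep (Mr k a1 a2 i) N ∧ N (V.r 0) = ⊥ ∧ N (V.r (Fin.last a2)) = ⊥} = i * a1 := by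
  have e : Nat.card (Fin i × Fin a1) = i * a1 := by simp
  rw [← e]
  symm
  refine Nat.card_eq_of_bijective
    (fun c : Fin i × Fin a1 => ⟨NN k a1 a2 i c.1 c.2, NN_sub hi2, ?_, ?_⟩) ⟨?_, ?_⟩
  · exact NN_bot (by simp [FF])
  · exact NN_bot (by simp only [FF, Fin.val_last]; omega)
  · rintro ⟨p, q⟩ ⟨p', q'⟩ h
    have h1 := FF_iff_of_NN hi1 (congrArg Subtype.val h)
    have hp := p.2
    have hp' := p'.2
    have hq := q.2
    have hq' := q'.2
    have e1 : (p : ℕ) = p' := by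
      rcases lt_trichotomy (p : ℕ) p' with h2 | h2 | h2
      · have := h1 (V.r ⟨p', by omega⟩)
        simp only [FF] at this
        omega
      · exact h2
      · have := h1 (V.r ⟨p, by omega⟩)
        simp only [FF] at this
        omega
    have e2 : (q : ℕ) = q' := by
      rcases lt_trichotomy (q : ℕ) q' with h2 | h2 | h2
      · have := h1 (V.t ⟨q, by omega⟩)
        simp only [FF] at this
        omega
      · exact h2
      · have := h1 (V.t ⟨q', by omega⟩)
        simp only [FF] at this
        omega
    exact Prod.ext (Fin.ext e1) (Fin.ext e2)
  · rintro ⟨N, hN, h0, hl⟩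
    obtain ⟨p, q, hp, hq, h⟩ := NN_surj ha1 hi1 hi2 N hN h0 hl
    exact ⟨(⟨p, hp⟩, ⟨q, hq⟩), Subtype.ext h⟩
end

section
/- A nonzero thin representation L of a finite quiver Q' over a field k is indecomposable (i.e. L is not isomorphic to a direct sum of two nonzero representations) if and only if its support quiver Q(L) is connected, where Q(L) is the quiver whose vertices are the vertices x with L_x ≠ 0 and whose arrows are the arrows α with φ_α ≠ 0. -/
/-- A representation of a quiver `V'` over a field `k`: a finite-dimensional `k`-vector space
at each vertex and a linear map for each arrow. -/
structure QRepn (k : Type) [Field k] (V' : Type) [Quiver.{1} V'] : Type 1 where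
  carrier : V' → Type
  [acg : ∀ x, AddCommGroup (carrier x)]
  [mod : ∀ x, Module k (carrier x)]
  fd : ∀ x, FiniteDimensional k (carrier x)
  map : ∀ {x y : V'}, (x ⟶ y) → (carrier x →ₗ[k] carrier y)

attribute [instance] QRepn.acg QRepn.mod

/-- The direct sum of two representations (vertexwise and arrowwise). -/
noncomputable def prodRepn {k : Type} [Field k] {V' : Type} [Quiver.{1} V']
    (ρ σ : QRepn k V') : QRepn k V' where
  carrier x := ρ.carrier x × σ.carrier x
  acg := fun _ => inferInstance
  mod := fun _ => inferInstance
  fd := fun x => by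
    have := ρ.fd x
    have := σ.fd x
    exact Module.Finite.prod
  map e := (ρ.map e).prodMap (σ.map e)

/-- A representation is nonzero if some vertex carries a nonzero vector. -/
def Nonzero {k : Type} [Field k] {V' : Type} [Quiver.{1} V'] (ρ : QRepn k V') : Prop :=
  ∃ (x : V') (v : ρ.carrier x), v ≠ 0

/-- Two representations are isomorphic if there is a morphism of representations which is
bijective at every vertex. -/
def IsIso {k : Type} [Field k] {V' : Type} [Quiver.{1} V'] (ρ σ : QRepn k V') : Prop :=
  ∃ f : ∀ x : V', ρ.carrier x →ₗ[k] σ.carrier x,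
    (∀ (x y : V') (e : x ⟶ y), (σ.map e).comp (f x) = (f y).comp (ρ.map e)) ∧
    ∀ x : V', Function.Bijective (f x)

/-- The support quiver of `ρ` is connected: any two vertices carrying a nonzero vector are
joined by a walk using only arrows whose structure map is nonzero. -/
def SuppConnected {k : Type} [Field k] {V' : Type} [Quiver.{1} V'] (ρ : QRepn k V') : Prop :=
  ∀ x y : V', (∃ v : ρ.carrier x, v ≠ 0) → (∃ v : ρ.carrier y, v ≠ 0) →
    Relation.ReflTransGen
      (fun a b => (∃ e : a ⟶ b, ρ.map e ≠ 0) ∨ (∃ e : b ⟶ a, ρ.map e ≠ 0)) x y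

open Classical in
/-- full space where `P` holds, zero elsewhere -/
noncomputable def sepSub {k : Type} [Field k] {V' : Type} [Quiver.{1} V'] (L : QRepn k V')
    (P : V' → Prop) (z : V') : Submodule k (L.carrier z) := if P z then ⊤ else ⊥

theorem sepSub_map {k : Type} [Field k] {V' : Type} [Quiver.{1} V'] (L : QRepn k V')
    (P : V' → Prop) (hP : ∀ (a b : V') (e : a ⟶ b), L.map e ≠ 0 → P a → P b)
    {a b : V'} (e : a ⟶ b) : ∀ v ∈ sepSub L P a, L.map e v ∈ sepSub L P b := by
  intro v hv
  by_cases h0 : L.map e = 0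
  · simp [h0]
  · by_cases ha : P a
    · simp [sepSub, hP a b e h0 ha]
    · simp only [sepSub, ha, if_false, Submodule.mem_bot] at hv
      simp [hv]

theorem sepSub_compl {k : Type} [Field k] {V' : Type} [Quiver.{1} V'] (L : QRepn k V')
    (P : V' → Prop) (z : V') : IsCompl (sepSub L P z) (sepSub L (fun w => ¬ P w) z) := by
  by_cases h : P z
  · simpa [sepSub, h] using isCompl_top_bot
  · simpa [sepSub, h] using isCompl_bot_top

/-- the corresponding subrepresentation -/
noncomputable def sepRepn {k : Type} [Field k] {V' : Type} [Quiver.{1} V'] (L : QRepn k V')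
    (P : V' → Prop) (hP : ∀ (a b : V') (e : a ⟶ b), L.map e ≠ 0 → P a → P b) : QRepn k V' where
  carrier z := sepSub L P z
  acg := fun _ => inferInstance
  mod := fun _ => inferInstance
  fd := fun x => by
    have := L.fd x
    infer_instance
  map e := (L.map e).restrict (sepSub_map L P hP e)

theorem sepRepn_nonzero {k : Type} [Field k] {V' : Type} [Quiver.{1} V'] (L : QRepn k V')
    (P : V' → Prop) (hP : ∀ (a b : V') (e : a ⟶ b), L.map e ≠ 0 → P a → P b)
    (x : V') (hx : P x) (v : L.carrier x) (hv : v ≠ 0) : Nonzero (sepRepn L P hP) := by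
  refine ⟨x, (⟨v, by simp [sepSub, hx]⟩ : sepSub L P x), ?_⟩
  intro h
  exact hv (congrArg Subtype.val h)

theorem sepRepn_iso {k : Type} [Field k] {V' : Type} [Quiver.{1} V'] (L : QRepn k V')
    (P : V' → Prop) (hP : ∀ (a b : V') (e : a ⟶ b), L.map e ≠ 0 → P a → P b)
    (hN : ∀ (a b : V') (e : a ⟶ b), L.map e ≠ 0 → ¬ P a → ¬ P b) :
    IsIso L (prodRepn (sepRepn L P hP) (sepRepn L (fun w => ¬ P w) hN)) := by
  let E := fun z => Submodule.prodEquivOfIsCompl _ _ (sepSub_compl L P z)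
  refine ⟨fun z => (E z).symm.toLinearMap, ?_, fun z => (E z).symm.bijective⟩
  intro a b e
  ext1 v
  obtain ⟨w, rfl⟩ := (E a).surjective v
  apply (E b).injective
  change E b (((L.map e).restrict (sepSub_map L P hP e)).prodMap
    ((L.map e).restrict (sepSub_map L _ hN e)) ((E a).symm (E a w))) =
      E b ((E b).symm (L.map e (E a w)))
  rw [LinearEquiv.apply_symm_apply, LinearEquiv.symm_apply_apply]
  simp [E]

theorem thin_not_both {k : Type} [Field k] {V' : Type} [Quiver.{1} V'] (L ρ σ : QRepn k V')
    (x : V') (hthin : Module.finrank k (L.carrier x) ≤ 1)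
    (f : L.carrier x →ₗ[k] ρ.carrier x × σ.carrier x) (hf : Function.Bijective f)
    (p : ρ.carrier x) (q : σ.carrier x) (hp : p ≠ 0) : q = 0 := by
  by_contra hq
  have := ρ.fd x
  have := σ.fd x
  have h := (LinearEquiv.ofBijective f hf).finrank_eq
  rw [Module.finrank_prod] at h
  have : Nontrivial (ρ.carrier x) := ⟨p, 0, hp⟩
  have : Nontrivial (σ.carrier x) := ⟨q, 0, hq⟩
  have h1 := Module.finrank_pos (R := k) (M := ρ.carrier x)
  have h2 := Module.finrank_pos (R := k) (M := σ.carrier x)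
  omega

/-- A nonzero thin representation `L` of a finite quiver over a field `k` is
indecomposable (not isomorphic to a direct sum of two nonzero representations) if and only
if its support quiver is connected. -/
theorem statement5 (k : Type) [Field k] (V' : Type) [Quiver.{1} V'] [Fintype V']
    [∀ x y : V', Finite (x ⟶ y)]
    (L : QRepn k V')
    (hthin : ∀ x : V', Module.finrank k (L.carrier x) ≤ 1)
    (hnz : Nonzero L) :
    (¬ ∃ ρ σ : QRepn k V', Nonzero ρ ∧ Nonzero σ ∧ IsIso L (prodRepn ρ σ)) ↔
      SuppConnected L := by
  constructor
  · intro hind x y ⟨v, hv⟩ ⟨w, hw⟩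
    by_contra hxy
    let P : V' → Prop := Relation.ReflTransGen
      (fun a b => (∃ e : a ⟶ b, L.map e ≠ 0) ∨ (∃ e : b ⟶ a, L.map e ≠ 0)) x
    have hP : ∀ (a b : V') (e : a ⟶ b), L.map e ≠ 0 → P a → P b :=
      fun a b e he ha => Relation.ReflTransGen.tail ha (Or.inl ⟨e, he⟩)
    have hN : ∀ (a b : V') (e : a ⟶ b), L.map e ≠ 0 → ¬ P a → ¬ P b :=
      fun a b e he ha hb => ha (Relation.ReflTransGen.tail hb (Or.inr ⟨e, he⟩))
    exact hind ⟨_, _, sepRepn_nonzero L P hP x Relation.ReflTransGen.refl v hv,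
      sepRepn_nonzero L (fun w => ¬ P w) hN y hxy w hw, sepRepn_iso L P hP hN⟩
  · rintro hc ⟨ρ, σ, ⟨x, p, hp⟩, ⟨y, q, hq⟩, f, hcomm, hbij⟩
    have hex : ∀ z, ∀ u : ρ.carrier z × σ.carrier z, u ≠ 0 → ∃ v : L.carrier z, v ≠ 0 := by
      intro z u hu
      obtain ⟨v, hv⟩ := (hbij z).2 u
      refine ⟨v, ?_⟩
      rintro rfl
      exact hu (hv.symm.trans (map_zero (f z)))
    have hboth : ∀ z (p : ρ.carrier z) (q : σ.carrier z), p ≠ 0 → q = 0 :=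
      fun z p q => thin_not_both L ρ σ z (hthin z) (f z) (hbij z) p q
    have hedge : ∀ (a b : V') (e : a ⟶ b), L.map e ≠ 0 →
        ((∃ p : ρ.carrier a, p ≠ 0) ↔ (∃ p : ρ.carrier b, p ≠ 0)) := by
      intro a b e he
      obtain ⟨v, hv⟩ : ∃ v, L.map e v ≠ 0 := by
        by_contra h
        push Not at h
        exact he (LinearMap.ext h)
      obtain ⟨u, hu⟩ : ∃ u : ρ.carrier a × σ.carrier a, u = f a v := ⟨_, rfl⟩
      have h1 : (ρ.map e u.1, σ.map e u.2) = f b (L.map e v) := by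
        rw [hu]
        exact LinearMap.congr_fun (hcomm a b e) v
      have h2 : ¬ (ρ.map e u.1 = 0 ∧ σ.map e u.2 = 0) := by
        rintro ⟨h3, h4⟩
        rw [h3, h4] at h1
        exact hv ((hbij b).1 (h1.symm.trans (map_zero (f b)).symm))
      constructor
      · rintro ⟨p, hp⟩
        refine ⟨ρ.map e u.1, fun h => h2 ⟨h, ?_⟩⟩
        rw [hboth a p u.2 hp, map_zero]
      · rintro ⟨p, hp⟩
        refine ⟨u.1, fun h => h2 ⟨by rw [h, map_zero], hboth b p _ hp⟩⟩
    have hwalk := hc x y (hex x (p, 0) (fun h => hp (congrArg Prod.fst h)))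
      (hex y (0, q) (fun h => hq (congrArg Prod.snd h)))
    have hy : ∃ p : ρ.carrier y, p ≠ 0 := by
      clear hq
      induction hwalk with
      | refl => exact ⟨p, hp⟩
      | tail _ h ih =>
        rcases h with ⟨e, he⟩ | ⟨e, he⟩
        · exact (hedge _ _ e he).1 (ih 0)
        · exact (hedge _ _ e he).2 (ih 0)
    obtain ⟨p', hp'⟩ := hy
    exact hq (hboth y p' q hp')
end

section
/- For all i, j with 1 ≤ i, j ≤ a1−1: the k-vector space Hom(M(t_i), M(t_j)) is zero if i < j, and has dimension 1 if i ≥ j. -/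
theorem thinMap_val_pos (k : Type) [Field k] {a1 a2 : ℕ} (S T : Set (V a1 a2))
    (x y : V a1 a2) (h : y ∈ T) (v : sp k S x) : ((thinMap k S T x y v : sp k T y) : k) = v := by
  simp [thinMap, h]

theorem thinMap_val_neg (k : Type) [Field k] {a1 a2 : ℕ} (S T : Set (V a1 a2))
    (x y : V a1 a2) (h : y ∉ T) (v : sp k S x) : ((thinMap k S T x y v : sp k T y) : k) = 0 := by
  simp [thinMap, h]

theorem sp_val_zero (k : Type) [Field k] {a1 a2 : ℕ} (S : Set (V a1 a2))
    (x : V a1 a2) (h : x ∉ S) (v : sp k S x) : (v : k) = 0 := by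
  obtain ⟨v, hv⟩ := v
  simpa [sp, h] using hv

open Classical in
noncomputable def spOne (k : Type) [Field k] {a1 a2 : ℕ} (S : Set (V a1 a2))
    (x : V a1 a2) : sp k S x :=
  if h : x ∈ S then ⟨1, by simp [sp, h]⟩ else 0

theorem spOne_pos (k : Type) [Field k] {a1 a2 : ℕ} (S : Set (V a1 a2))
    (x : V a1 a2) (h : x ∈ S) : (spOne k S x : k) = 1 := by
  simp [spOne, h]

theorem eq_smul_spOne (k : Type) [Field k] {a1 a2 : ℕ} (S : Set (V a1 a2))
    (x : V a1 a2) (v : sp k S x) : v = (v : k) • spOne k S x := by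
  apply Subtype.ext
  by_cases h : x ∈ S
  · simp [spOne_pos k S x h]
  · simp [sp_val_zero k S x h]

/-- scalar of a family at a vertex -/
noncomputable def coef {k : Type} [Field k] {a1 a2 : ℕ} {S T : Set (V a1 a2)}
    (f : ∀ x, sp k S x →ₗ[k] sp k T x) (x : V a1 a2) : k := (f x (spOne k S x) : sp k T x)

theorem apply_eq_coef {k : Type} [Field k] {a1 a2 : ℕ} {S T : Set (V a1 a2)}
    (f : ∀ x, sp k S x →ₗ[k] sp k T x) (x : V a1 a2) (v : sp k S x) :
    ((f x v : sp k T x) : k) = (v : k) * coef f x := by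
  conv_lhs => rw [eq_smul_spOne k S x v]
  simp [coef]

theorem coef_arrow {k : Type} [Field k] {a1 a2 : ℕ} {S T : Set (V a1 a2)}
    (f : ∀ x, sp k S x →ₗ[k] sp k T x)
    (hf : f ∈ HomSpace (thinRep k S) (thinRep k T)) (x y : V a1 a2) (h : Arrow a1 a2 x y)
    (hx : x ∈ S) (hy : y ∈ S) (hy' : y ∈ T) : coef f x = coef f y := by
  have h1 : (thinMap k T T x y).comp (f x) = (f y).comp (thinMap k S S x y) := hf x y h
  have h2 := congrArg (fun w : sp k T y => (w : k)) (LinearMap.congr_fun h1 (spOne k S x))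
  simp only [LinearMap.comp_apply] at h2
  rw [thinMap_val_pos k T T x y hy', apply_eq_coef f y, thinMap_val_pos k S S x y hy,
    spOne_pos k S x hx, one_mul] at h2
  exact h2

theorem coef_r {k : Type} [Field k] {a1 a2 i j : ℕ}
    (f : ∀ x, sp k (suppT a1 a2 i) x →ₗ[k] sp k (suppT a1 a2 j) x)
    (hf : f ∈ HomSpace (Mt k a1 a2 i) (Mt k a1 a2 j)) (d : ℕ) :
    ∀ (n : Fin (a2 + 1)), 1 ≤ (n : ℕ) → (n : ℕ) + d = a2 →
      coef f (.r n) = coef f (.r (Fin.last a2)) := by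
  induction d with
  | zero =>
    intro n _ h
    congr 2
    exact Fin.ext (by simpa using h)
  | succ d ih =>
    intro n hn h
    have := ih ⟨n + 1, by omega⟩ (by simp) (by simp; omega)
    rw [← this]
    apply coef_arrow f hf
    · simp [Arrow]
    · simpa [suppT] using hn
    · simp [suppT]
    · simp [suppT]

theorem coef_s {k : Type} [Field k] {a1 a2 i j : ℕ} (ha2 : 0 < a2)
    (f : ∀ x, sp k (suppT a1 a2 i) x →ₗ[k] sp k (suppT a1 a2 j) x)
    (hf : f ∈ HomSpace (Mt k a1 a2 i) (Mt k a1 a2 j)) (d : ℕ) :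
    ∀ (n : Fin (a1 - 1)), i ≤ (n : ℕ) → j ≤ (n : ℕ) + 1 → (n : ℕ) + d = a1 - 2 →
      coef f (.s n) = coef f (.r (Fin.last a2)) := by
  induction d with
  | zero =>
    intro n hn hn' h
    apply coef_arrow f hf
    · simpa [Arrow] using h
    · simpa [suppT] using hn
    · simp [suppT]; omega
    · simp [suppT]; omega
  | succ d ih =>
    intro n hn hn' h
    have := ih ⟨n + 1, by omega⟩ (by simp; omega) (by simp; omega) (by simp; omega)
    rw [← this]
    apply coef_arrow f hf
    · simp [Arrow]
    · simpa [suppT] using hn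
    · simp [suppT]; omega
    · simp [suppT]; omega

theorem hom_apply {k : Type} [Field k] {a1 a2 i j : ℕ} (ha2 : 0 < a2)
    (f : ∀ x, sp k (suppT a1 a2 i) x →ₗ[k] sp k (suppT a1 a2 j) x)
    (hf : f ∈ HomSpace (Mt k a1 a2 i) (Mt k a1 a2 j)) :
    f = coef f (.r (Fin.last a2)) • fun x => thinMap k (suppT a1 a2 i) (suppT a1 a2 j) x x := by
  funext x
  apply LinearMap.ext
  intro v
  apply Subtype.ext
  simp only [Pi.smul_apply, LinearMap.smul_apply, Submodule.coe_smul, smul_eq_mul]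
  by_cases hT : x ∈ suppT a1 a2 j
  · rw [thinMap_val_pos _ _ _ _ _ hT, apply_eq_coef, mul_comm]
    by_cases hS : x ∈ suppT a1 a2 i
    · congr 1
      match x, hT, hS with
      | .r n, hT, hS => exact coef_r f hf (a2 - n) n hT (by omega)
      | .s n, hT, hS => exact coef_s ha2 f hf (a1 - 2 - n) n hS (Nat.le_succ_of_le hT) (by omega)
    · rw [sp_val_zero k _ x hS v]; simp
  · rw [sp_val_zero k _ x hT, thinMap_val_neg _ _ _ _ _ hT, mul_zero]

theorem thin_mem (k : Type) [Field k] {a1 a2 i j : ℕ} (ha2 : 0 < a2) (hij : j ≤ i) :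
    (fun x => thinMap k (suppT a1 a2 i) (suppT a1 a2 j) x x) ∈
      HomSpace (Mt k a1 a2 i) (Mt k a1 a2 j) := by
  intro x y h
  change (thinMap k (suppT a1 a2 j) (suppT a1 a2 j) x y).comp
      (thinMap k (suppT a1 a2 i) (suppT a1 a2 j) x x) =
    (thinMap k (suppT a1 a2 i) (suppT a1 a2 j) y y).comp
      (thinMap k (suppT a1 a2 i) (suppT a1 a2 i) x y)
  apply LinearMap.ext
  intro v
  apply Subtype.ext
  simp only [LinearMap.comp_apply]
  by_cases hy : y ∈ suppT a1 a2 j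
  · rw [thinMap_val_pos _ _ _ _ _ hy, thinMap_val_pos _ _ _ _ _ hy]
    by_cases hx : x ∈ suppT a1 a2 i
    · have hx' : x ∈ suppT a1 a2 j := by
        match x, hx with
        | .r n, hx => exact hx
        | .s n, hx => exact le_trans hij hx
      have hy' : y ∈ suppT a1 a2 i := by
        match x, y, hx, hy, h with
        | .r n, .r m, hx, hy, h => exact hy
        | .s n, .r m, hx, hy, h => exact hy
        | .s n, .s m, hx, hy, h =>
          have h1 : i ≤ (n : ℕ) := hx
          have h2 : (n : ℕ) + 1 = m := h
          show i ≤ (m : ℕ)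
          omega
      rw [thinMap_val_pos _ _ _ _ _ hx', thinMap_val_pos _ _ _ _ _ hy']
    · have : v = 0 := Subtype.ext (sp_val_zero k _ x hx v)
      subst this
      simp
  · rw [thinMap_val_neg _ _ _ _ _ hy, thinMap_val_neg _ _ _ _ _ hy]

/-- For `1 ≤ i, j ≤ a1 - 1`, `Hom(M(t_i), M(t_j))` is zero if `i < j` and is
one-dimensional if `i ≥ j`. -/
theorem statement11 (k : Type) [Field k] (a1 a2 : ℕ) (ha1 : 0 < a1) (ha2 : 0 < a2)
    (i j : ℕ) (hi1 : 1 ≤ i) (hi2 : i ≤ a1 - 1) (hj1 : 1 ≤ j) (hj2 : j ≤ a1 - 1) :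
    (i < j → HomSpace (Mt k a1 a2 i) (Mt k a1 a2 j) = ⊥) ∧
    (j ≤ i → Module.finrank k ↥(HomSpace (Mt k a1 a2 i) (Mt k a1 a2 j)) = 1) := by
  refine ⟨fun hij => ?_, fun hij => ?_⟩
  · rw [Submodule.eq_bot_iff]
    intro f hf
    have h0 := hom_apply ha2 f hf
    have h1 := coef_s ha2 f hf (a1 - 2 - (j - 1)) ⟨j - 1, by omega⟩
      (by simp; omega) (by simp; omega) (by simp; omega)
    have h2 : coef (S := suppT a1 a2 i) (T := suppT a1 a2 j) f (.s ⟨j - 1, by omega⟩) = 0 := by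
      apply sp_val_zero
      simp [suppT]
      omega
    rw [← h1, h2, zero_smul] at h0
    exact h0
  · refine finrank_eq_one_iff'.mpr
      ⟨⟨fun x => thinMap k (suppT a1 a2 i) (suppT a1 a2 j) x x, thin_mem k ha2 hij⟩, ?_, ?_⟩
    · intro h
      have hm : ∀ i, (V.r (Fin.last a2) : V a1 a2) ∈ suppT a1 a2 i := by
        intro i
        simp [suppT]
        omega
      have h1 := congrFun (congrArg Subtype.val h) (.r (Fin.last a2))
      have h2 : ((thinMap k (suppT a1 a2 i) (suppT a1 a2 j) (.r (Fin.last a2)) (.r (Fin.last a2))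
          (spOne k _ _) : sp k _ _) : k) = 0 :=
        congrArg Subtype.val (LinearMap.congr_fun h1 (spOne k _ _))
      rw [thinMap_val_pos _ _ _ _ _ (hm j), spOne_pos _ _ _ (hm i)] at h2
      exact one_ne_zero h2
    · rintro ⟨f, hf⟩
      exact ⟨_, Subtype.ext (hom_apply ha2 f hf).symm⟩
end

section
/- For all i, j with 0 ≤ i ≤ a2 and 1 ≤ j ≤ a1−1, every morphism of representations M(r_i) → M(t_j) is zero, i.e. Hom(M(r_i), M(t_j)) = 0. -/
section helpers

variable {k : Type} [Field k] {a1 a2 : ℕ} {S T : Set (V a1 a2)}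

theorem aux_src {x : V a1 a2} (f : sp k S x →ₗ[k] sp k T x) (h : x ∉ S) : f = 0 := by
  ext v
  have hv : v = 0 := by
    have := v.2
    simp only [sp, if_neg h, Submodule.mem_bot] at this
    exact Subtype.ext this
  rw [hv]; simp

theorem aux_tgt {x : V a1 a2} (f : sp k S x →ₗ[k] sp k T x) (h : x ∉ T) : f = 0 := by
  ext v
  have := (f v).2
  simp only [sp, if_neg h, Submodule.mem_bot] at this
  exact this

theorem aux_fwd {x y : V a1 a2} (f : sp k S x →ₗ[k] sp k T x) (g : sp k S y →ₗ[k] sp k T y)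
    (h : (thinMap k T T x y).comp f = g.comp (thinMap k S S x y)) (hx : x ∈ S) (hf : f = 0) :
    g = 0 := by
  by_cases hy : y ∈ S
  · apply LinearMap.ext
    intro v
    have h1 := LinearMap.congr_fun h ⟨(v : k), by simp [sp, hx]⟩
    have h2 : thinMap k S S x y ⟨(v : k), by simp [sp, hx]⟩ = v := by
      simp [thinMap, hy]
    rw [LinearMap.comp_apply, LinearMap.comp_apply, h2, hf] at h1
    rw [← h1]; simp
  · exact aux_src g hy

theorem aux_bwd {x y : V a1 a2} (f : sp k S x →ₗ[k] sp k T x) (g : sp k S y →ₗ[k] sp k T y)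
    (h : (thinMap k T T x y).comp f = g.comp (thinMap k S S x y)) (hy : y ∈ T) (hg : g = 0) :
    f = 0 := by
  apply LinearMap.ext
  intro v
  have h1 := LinearMap.congr_fun h v
  rw [LinearMap.comp_apply, LinearMap.comp_apply, hg, LinearMap.zero_apply] at h1
  have h2 := congrArg Subtype.val h1
  simp only [thinMap, LinearMap.coe_mk, AddHom.coe_mk, dif_pos hy] at h2
  exact Subtype.ext h2

end helpers

/-- For `0 ≤ i ≤ a2` and `1 ≤ j ≤ a1 - 1`, every morphism of representations
`M(r_i) → M(t_j)` is zero, i.e. `Hom(M(r_i), M(t_j)) = 0`. -/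
theorem statement15 (k : Type) [Field k] (a1 a2 : ℕ) (ha1 : 0 < a1) (ha2 : 0 < a2)
    (i j : ℕ) (hi : i ≤ a2) (hj1 : 1 ≤ j) (hj2 : j ≤ a1 - 1) :
    HomSpace (Mr k a1 a2 i) (Mt k a1 a2 j) = ⊥ := by
  rw [eq_bot_iff]
  intro f hf
  rw [Submodule.mem_bot]
  let g : ∀ x, sp k (suppR a1 a2 i) x →ₗ[k] sp k (suppT a1 a2 j) x := f
  have hg : ∀ (x y : V a1 a2), Arrow a1 a2 x y →
      (thinMap k (suppT a1 a2 j) (suppT a1 a2 j) x y).comp (g x)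
        = (g y).comp (thinMap k (suppR a1 a2 i) (suppR a1 a2 i) x y) := hf
  suffices H : ∀ x, g x = 0 from funext H
  have ht : ∀ n, g (.t n) = 0 := fun n => aux_tgt _ (by simp [suppT])
  have hr0 : ∀ h, g (.r ⟨0, h⟩) = 0 := fun h => aux_tgt _ (by simp [suppT])
  by_cases hia : i = a2
  · have hs : ∀ n, g (.s n) = 0 := fun n => aux_src _ (by simp [suppR, hia])
    have hr : ∀ n (h : n < a2 + 1), g (.r ⟨n, h⟩) = 0 := by
      intro n
      induction n with
      | zero => exact hr0
      | succ n ih =>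
        intro h
        refine aux_fwd _ _ (hg (.r ⟨n, by omega⟩) _ ?_) ?_ (ih _)
        · simp [Arrow]
        · simp only [suppR, Set.mem_ofPred_eq]; omega
    rintro (n | n | n)
    · exact hr n.1 n.2
    · exact hs n
    · exact ht n
  · have hs : ∀ n (h : n < a1 - 1), g (.s ⟨n, h⟩) = 0 := by
      intro n
      induction n with
      | zero =>
        intro h
        exact aux_tgt _ (by simp only [suppT, Set.mem_ofPred_eq]; omega)
      | succ n ih =>
        intro h
        refine aux_fwd _ _ (hg (.s ⟨n, by omega⟩) _ ?_) ?_ (ih _)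
        · simp [Arrow]
        · simpa [suppR] using hia
    have hr : ∀ d n (h : n < a2 + 1), n + d = a2 → g (.r ⟨n, h⟩) = 0 := by
      intro d
      induction d with
      | zero =>
        intro n h hn
        refine aux_fwd _ _ (hg (.s ⟨a1 - 2, by omega⟩) _ ?_) ?_ (hs _ _)
        · exact ⟨rfl, by simpa using hn⟩
        · simpa [suppR] using hia
      | succ d ih =>
        intro n h hn
        refine aux_bwd _ _ (hg _ (.r ⟨n + 1, by omega⟩) ?_) ?_ (ih _ _ (by omega))
        · simp [Arrow]
        · simp [suppT]
    rintro (n | n | n)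
    · exact hr (a2 - n.1) n.1 n.2 (by omega)
    · exact hs n.1 n.2
    · exact ht n
end

section
/- For all i, j with 1 ≤ i, j ≤ a1−1, every morphism of representations M(s_i) → M(t_j) is zero, i.e. Hom(M(s_i), M(t_j)) = 0. -/
theorem sp_eq_zero {k : Type} [Field k] {a1 a2 : ℕ} {S : Set (V a1 a2)} {x : V a1 a2}
    (h : x ∉ S) (v : sp k S x) : v = 0 := by
  have := v.2
  simp only [sp, if_neg h, Submodule.mem_bot] at this
  exact Subtype.ext this

theorem r_zero {k : Type} [Field k] {a1 a2 : ℕ} {i j : ℕ}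
    (f : ∀ x : V a1 a2, sp k (suppS a1 a2 i) x →ₗ[k] sp k (suppT a1 a2 j) x)
    (hf : ∀ (x y : V a1 a2), Arrow a1 a2 x y →
      (thinMap k (suppT a1 a2 j) (suppT a1 a2 j) x y).comp (f x) =
        (f y).comp (thinMap k (suppS a1 a2 i) (suppS a1 a2 i) x y)) :
    ∀ (n : ℕ) (hn : n < a2 + 1), f (.r ⟨n, hn⟩) = 0 := by
  intro n
  induction n with
  | zero =>
    intro hn
    ext v
    rw [sp_eq_zero (x := V.r ⟨0, hn⟩) (S := suppT a1 a2 j) (by simp [suppT]) (f _ v)]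
    rfl
  | succ n ih =>
    intro hn
    apply LinearMap.ext
    intro v
    by_cases h : n + 1 < a2
    · have hx : (V.r ⟨n, by omega⟩ : V a1 a2) ∈ suppS a1 a2 i := by
        simp only [suppS, Set.mem_setOf_eq]; omega
      have hy : (V.r ⟨n + 1, hn⟩ : V a1 a2) ∈ suppS a1 a2 i := by
        simp only [suppS, Set.mem_setOf_eq]; omega
      have e := hf (.r ⟨n, by omega⟩) (.r ⟨n + 1, hn⟩) (Or.inl rfl)
      rw [ih (by omega), LinearMap.comp_zero] at e
      have e2 := LinearMap.congr_fun e ⟨(v : k), by simp [sp, hx]⟩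
      have e3 : thinMap k (suppS a1 a2 i) (suppS a1 a2 i) (.r ⟨n, by omega⟩) (.r ⟨n + 1, hn⟩)
          ⟨(v : k), by simp [sp, hx]⟩ = v := by
        simp [thinMap, hy]
      rw [LinearMap.comp_apply, e3] at e2
      exact e2.symm
    · rw [sp_eq_zero (x := V.r ⟨n + 1, hn⟩) (S := suppS a1 a2 i)
        (by simp only [suppS, Set.mem_setOf_eq]; omega) v, map_zero, map_zero]

/-- For `1 ≤ i, j ≤ a1 - 1`, every morphism of representations
`M(s_i) → M(t_j)` is zero, i.e. `Hom(M(s_i), M(t_j)) = 0`. -/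
theorem statement17 (k : Type) [Field k] (a1 a2 : ℕ) (ha1 : 0 < a1) (ha2 : 0 < a2)
    (i j : ℕ) (hi1 : 1 ≤ i) (hi2 : i ≤ a1 - 1) (hj1 : 1 ≤ j) (hj2 : j ≤ a1 - 1) :
    HomSpace (Ms k a1 a2 i) (Mt k a1 a2 j) = ⊥ := by
  rw [eq_bot_iff]
  intro f hf
  rw [Submodule.mem_bot]
  funext x
  cases x with
  | r n => exact r_zero (i := i) (j := j) f hf n.1 n.2
  | s n =>
    apply LinearMap.ext
    intro v
    have hv : v = 0 := sp_eq_zero (x := V.s n) (S := suppS a1 a2 i) (by simp [suppS]) v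
    rw [hv, map_zero, map_zero]
  | t n =>
    apply LinearMap.ext
    intro v
    exact sp_eq_zero (x := V.t n) (S := suppT a1 a2 j) (by simp [suppT]) (f (V.t n) v)
end
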